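/- Let θ_{0,−1} = (−z¹ + e^{2z³})/(z¹ − √2 z² e^{z³})², θ_{0,0} = z³ − log(z¹ − √2 z² e^{z³}), and θ_{0,1} = z¹z³ + ½(z²)². Then on the domain where z¹ > 0 and z¹ − √2 z² e^{z³} > 0, these functions satisfy the Principal Hierarchy recursion relations: for all α,β ∈ {1,2,3}, ∂²θ_{0,0}/∂z^α∂z^β = Σ_γ c^γ_{αβ} ∂θ_{0,−1}/∂z^γ and ∂²θ_{0,1}/∂z^α∂z^β = Σ_γ c^γ_{αβ} ∂θ_{0,0}/∂z^γ. -/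

import Mathlib

/-- Partial derivative in the first slot. -/
noncomputable def pd1 (f : ℝ → ℝ → ℝ → ℝ) : ℝ → ℝ → ℝ → ℝ :=
  fun x y z => deriv (fun t => f t y z) x

/-- Partial derivative in the second slot. -/
noncomputable def pd2 (f : ℝ → ℝ → ℝ → ℝ) : ℝ → ℝ → ℝ → ℝ :=
  fun x y z => deriv (fun t => f x t z) y

/-- Partial derivative in the third slot. -/
noncomputable def pd3 (f : ℝ → ℝ → ℝ → ℝ) : ℝ → ℝ → ℝ → ℝ :=
  fun x y z => deriv (fun t => f x y t) z

/-- Partial derivative in the (i+1)-st variable. -/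
noncomputable def pd (i : Fin 3) : (ℝ → ℝ → ℝ → ℝ) → (ℝ → ℝ → ℝ → ℝ) :=
  ![pd1, pd2, pd3] i

/-- The potential of the generalized Frobenius manifold of the (2,1)-type RR2T. -/
noncomputable def Fpot (x y z : ℝ) : ℝ :=
  (1/2) * x^2 * z + (1/2) * x * y^2 + Real.sqrt 2 * x * y * Real.exp z
    + (1/2) * x * Real.exp (2*z) - (1/24) * y^4 + (1/2) * x^2 * Real.log x

/-- The flat metric η, with η_{αβ} = 1 iff α + β = 4 (indices shifted to 0,1,2). -/
noncomputable def eta (a b : Fin 3) : ℝ := if (a : ℕ) + (b : ℕ) = 2 then 1 else 0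

/-- Third partial derivatives c_{αβγ} = ∂³F/∂z^α∂z^β∂z^γ of the potential. -/
noncomputable def cF (a b g : Fin 3) : ℝ → ℝ → ℝ → ℝ := pd a (pd b (pd g Fpot))

/-- Structure constants with one index raised: c^γ_{αβ} = Σ_δ η^{γδ} c_{δαβ}. -/
noncomputable def cup (g a b : Fin 3) (x y z : ℝ) : ℝ :=
  ∑ d : Fin 3, eta g d * cF d a b x y z

/-- θ_{0,−1}. -/
noncomputable def θ0m1 (x y z : ℝ) : ℝ :=
  (-x + Real.exp (2*z)) / (x - Real.sqrt 2 * y * Real.exp z)^2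

/-- θ_{0,0}. -/
noncomputable def θ00 (x y z : ℝ) : ℝ :=
  z - Real.log (x - Real.sqrt 2 * y * Real.exp z)

/-- θ_{0,1}. -/
noncomputable def θ01 (x y z : ℝ) : ℝ := x*z + (1/2)*y^2

open scoped Topology in
/-- Partial derivatives at a point of an open set depend only on the values on that set. -/
theorem pd_congr_of_isOpen {U : Set (ℝ × ℝ × ℝ)} (hU : IsOpen U) {f g : ℝ → ℝ → ℝ → ℝ}
    (h : ∀ x y z, (x, y, z) ∈ U → f x y z = g x y z) (i : Fin 3) {x y z : ℝ}
    (hp : (x, y, z) ∈ U) : pd i f x y z = pd i g x y z := by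
  have hn : U ∈ 𝓝 (x, y, z) := hU.mem_nhds hp
  have h₁ : ∀ᶠ t in 𝓝 x, (t, y, z) ∈ U :=
    (Continuous.prodMk_left (y, z)).continuousAt.eventually_mem hn
  have h₂ : ∀ᶠ t in 𝓝 y, (x, t, z) ∈ U :=
    (show Continuous fun t : ℝ => (x, t, z) by fun_prop).continuousAt.eventually_mem hn
  have h₃ : ∀ᶠ t in 𝓝 z, (x, y, t) ∈ U :=
    (show Continuous fun t : ℝ => (x, y, t) by fun_prop).continuousAt.eventually_mem hn
  fin_cases i
  · exact Filter.EventuallyEq.deriv_eq (h₁.mono fun t ht => h t y z ht)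
  · exact Filter.EventuallyEq.deriv_eq (h₂.mono fun t ht => h x t z ht)
  · exact Filter.EventuallyEq.deriv_eq (h₃.mono fun t ht => h x y t ht)

/-- The half-space where the potential is smooth. -/
def potentialDomain : Set (ℝ × ℝ × ℝ) := {p | 0 < p.1}

theorem isOpen_potentialDomain : IsOpen potentialDomain :=
  isOpen_lt continuous_const continuous_fst

/-- The domain of `θ00` and `θ0m1`. -/
def thetaDomain : Set (ℝ × ℝ × ℝ) := {p | 0 < p.1 - Real.sqrt 2 * p.2.1 * Real.exp p.2.2}

theorem isOpen_thetaDomain : IsOpen thetaDomain :=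
  isOpen_lt continuous_const (by fun_prop)

/-- The gradient of `Fpot`. -/
noncomputable def gradFpot : Fin 3 → ℝ → ℝ → ℝ → ℝ :=
  ![fun x y z => x * z + y ^ 2 / 2 + Real.sqrt 2 * y * Real.exp z + Real.exp (2 * z) / 2
      + x * Real.log x + x / 2,
    fun x y z => x * y + Real.sqrt 2 * x * Real.exp z - y ^ 3 / 6,
    fun x y z => x ^ 2 / 2 + Real.sqrt 2 * x * y * Real.exp z + x * Real.exp (2 * z)]

/-- The Hessian of `Fpot`. -/
noncomputable def hessFpot : Fin 3 → Fin 3 → ℝ → ℝ → ℝ → ℝ :=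
  ![![fun x _ z => z + Real.log x + 3 / 2,
      fun _ y z => y + Real.sqrt 2 * Real.exp z,
      fun x y z => x + Real.sqrt 2 * y * Real.exp z + Real.exp (2 * z)],
    ![fun _ y z => y + Real.sqrt 2 * Real.exp z,
      fun x y _ => x - y ^ 2 / 2,
      fun x _ z => Real.sqrt 2 * x * Real.exp z],
    ![fun x y z => x + Real.sqrt 2 * y * Real.exp z + Real.exp (2 * z),
      fun x _ z => Real.sqrt 2 * x * Real.exp z,
      fun x y z => Real.sqrt 2 * x * y * Real.exp z + 2 * x * Real.exp (2 * z)]]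

/-- The third derivatives of `Fpot`. -/
noncomputable def thirdFpot (x y z : ℝ) : Fin 3 → Fin 3 → Fin 3 → ℝ :=
  ![![![1 / x, 0, 1],
      ![0, 1, Real.sqrt 2 * Real.exp z],
      ![1, Real.sqrt 2 * Real.exp z, Real.sqrt 2 * y * Real.exp z + 2 * Real.exp (2 * z)]],
    ![![0, 1, Real.sqrt 2 * Real.exp z],
      ![1, -y, 0],
      ![Real.sqrt 2 * Real.exp z, 0, Real.sqrt 2 * x * Real.exp z]],
    ![![1, Real.sqrt 2 * Real.exp z, Real.sqrt 2 * y * Real.exp z + 2 * Real.exp (2 * z)],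
      ![Real.sqrt 2 * Real.exp z, 0, Real.sqrt 2 * x * Real.exp z],
      ![Real.sqrt 2 * y * Real.exp z + 2 * Real.exp (2 * z), Real.sqrt 2 * x * Real.exp z,
        Real.sqrt 2 * x * y * Real.exp z + 4 * x * Real.exp (2 * z)]]]

theorem pd_Fpot (i : Fin 3) {x y z : ℝ} (h : (x, y, z) ∈ potentialDomain) :
    pd i Fpot x y z = gradFpot i x y z := by
  have hx : x ≠ 0 := ne_of_gt h
  fin_cases i <;> simp only [pd, pd1, pd2, pd3, Fpot, gradFpot, Fin.zero_eta,
      Fin.mk_one, Fin.reduceFinMk, Matrix.cons_val] <;>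
    simp (disch := fun_prop (disch := assumption)) <;>
    field_simp <;> ring

theorem pd_gradFpot (i j : Fin 3) {x y z : ℝ} (h : (x, y, z) ∈ potentialDomain) :
    pd i (gradFpot j) x y z = hessFpot i j x y z := by
  have hx : x ≠ 0 := ne_of_gt h
  fin_cases i <;> fin_cases j <;> simp only [pd, pd1, pd2, pd3, gradFpot, hessFpot, Fin.zero_eta,
      Fin.mk_one, Fin.reduceFinMk, Matrix.cons_val] <;>
    simp (disch := fun_prop (disch := assumption)) <;>
    field_simp <;> ring

theorem pd_hessFpot (i j k : Fin 3) {x y z : ℝ} (h : (x, y, z) ∈ potentialDomain) :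
    pd i (hessFpot j k) x y z = thirdFpot x y z i j k := by
  have hx : x ≠ 0 := ne_of_gt h
  fin_cases i <;> fin_cases j <;> fin_cases k <;>
    simp only [pd, pd1, pd2, pd3, hessFpot, thirdFpot, Fin.zero_eta,
      Fin.mk_one, Fin.reduceFinMk, Matrix.cons_val] <;>
    simp (disch := fun_prop (disch := assumption)) <;>
    ring

theorem cF_eq (i j k : Fin 3) {x y z : ℝ} (h : (x, y, z) ∈ potentialDomain) :
    cF i j k x y z = thirdFpot x y z i j k := by
  have hess : ∀ x y z, (x, y, z) ∈ potentialDomain →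
      pd j (pd k Fpot) x y z = hessFpot j k x y z := fun x y z h => by
    rw [pd_congr_of_isOpen isOpen_potentialDomain (fun _ _ _ => pd_Fpot k) j h, pd_gradFpot j k h]
  rw [cF, pd_congr_of_isOpen isOpen_potentialDomain hess i h, pd_hessFpot i j k h]

/-- The gradient of `θ00`. -/
noncomputable def gradθ00 : Fin 3 → ℝ → ℝ → ℝ → ℝ :=
  ![fun x y z => -1 / (x - Real.sqrt 2 * y * Real.exp z),
    fun x y z => Real.sqrt 2 * Real.exp z / (x - Real.sqrt 2 * y * Real.exp z),
    fun x y z => x / (x - Real.sqrt 2 * y * Real.exp z)]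

/-- The Hessian of `θ00`. -/
noncomputable def hessθ00 (x y z : ℝ) : Fin 3 → Fin 3 → ℝ :=
  let E := Real.exp z
  let D := x - Real.sqrt 2 * y * E
  ![![1 / D ^ 2, -(Real.sqrt 2 * E) / D ^ 2, -(Real.sqrt 2 * y * E) / D ^ 2],
    ![-(Real.sqrt 2 * E) / D ^ 2, 2 * E ^ 2 / D ^ 2, Real.sqrt 2 * x * E / D ^ 2],
    ![-(Real.sqrt 2 * y * E) / D ^ 2, Real.sqrt 2 * x * E / D ^ 2,
      Real.sqrt 2 * x * y * E / D ^ 2]]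

/-- The gradient of `θ0m1`. -/
noncomputable def gradθ0m1 (x y z : ℝ) : Fin 3 → ℝ :=
  let E := Real.exp z
  let D := x - Real.sqrt 2 * y * E
  ![-1 / D ^ 2 - 2 * (E ^ 2 - x) / D ^ 3,
    2 * Real.sqrt 2 * E * (E ^ 2 - x) / D ^ 3,
    2 * E ^ 2 / D ^ 2 + 2 * Real.sqrt 2 * y * E * (E ^ 2 - x) / D ^ 3]

theorem exp_two_mul_eq_sq (z : ℝ) : Real.exp (2 * z) = Real.exp z ^ 2 := by
  rw [← Real.exp_nat_mul]; norm_num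

theorem pd_θ00 (i : Fin 3) {x y z : ℝ} (h : (x, y, z) ∈ thetaDomain) :
    pd i θ00 x y z = gradθ00 i x y z := by
  have hD : x - Real.sqrt 2 * y * Real.exp z ≠ 0 := ne_of_gt h
  fin_cases i <;> simp only [pd, pd1, pd2, pd3, θ00, gradθ00, Fin.zero_eta,
      Fin.mk_one, Fin.reduceFinMk, Matrix.cons_val] <;>
    simp (disch := first | assumption | fun_prop (disch := assumption)) [deriv.log] <;>
    field_simp <;> ring

theorem pd_gradθ00 (i j : Fin 3) {x y z : ℝ} (h : (x, y, z) ∈ thetaDomain) :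
    pd i (gradθ00 j) x y z = hessθ00 x y z i j := by
  have hD : x - Real.sqrt 2 * y * Real.exp z ≠ 0 := ne_of_gt h
  have hs : Real.sqrt 2 ^ 2 = 2 := Real.sq_sqrt (by norm_num)
  fin_cases i <;> fin_cases j <;> simp only [pd, pd1, pd2, pd3, gradθ00, hessθ00, Fin.zero_eta,
      Fin.mk_one, Fin.reduceFinMk, Matrix.cons_val] <;>
    simp (disch := first | assumption | fun_prop (disch := assumption)) <;>
    field_simp <;> grind

theorem pd_θ0m1 (i : Fin 3) {x y z : ℝ} (h : (x, y, z) ∈ thetaDomain) :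
    pd i θ0m1 x y z = gradθ0m1 x y z i := by
  have hD : x - Real.sqrt 2 * y * Real.exp z ≠ 0 := ne_of_gt h
  have hD2 : (x - Real.sqrt 2 * y * Real.exp z) ^ 2 ≠ 0 := pow_ne_zero 2 hD
  fin_cases i <;> simp only [pd, pd1, pd2, pd3, θ0m1, gradθ0m1, Fin.zero_eta,
      Fin.mk_one, Fin.reduceFinMk, Matrix.cons_val] <;>
    simp (disch := first | assumption | fun_prop (disch := assumption)) [exp_two_mul_eq_sq] <;>
    field_simp <;> ring

/-- The gradient of `θ01`. -/
noncomputable def gradθ01 : Fin 3 → ℝ → ℝ → ℝ → ℝ :=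
  ![fun _ _ z => z, fun _ y _ => y, fun x _ _ => x]

theorem pd_θ01 (i : Fin 3) : pd i θ01 = gradθ01 i := by
  ext x y z
  fin_cases i <;> simp [pd, pd1, pd2, pd3, θ01, gradθ01]

theorem pd_gradθ01 (i j : Fin 3) (x y z : ℝ) : pd i (gradθ01 j) x y z = eta i j := by
  fin_cases i <;> fin_cases j <;> simp [pd, pd1, pd2, pd3, gradθ01, eta]

/-- the Principal Hierarchy recursion relations for θ_{0,−1}, θ_{0,0}, θ_{0,1}. -/
theorem recursion_theta0 (x y z : ℝ) (hx : 0 < x)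
    (hD : 0 < x - Real.sqrt 2 * y * Real.exp z) :
    (∀ α β : Fin 3,
      pd α (pd β θ00) x y z = ∑ γ : Fin 3, cup γ α β x y z * pd γ θ0m1 x y z)
    ∧ (∀ α β : Fin 3,
      pd α (pd β θ01) x y z = ∑ γ : Fin 3, cup γ α β x y z * pd γ θ00 x y z) := by
  have hF : (x, y, z) ∈ potentialDomain := hx
  have hT : (x, y, z) ∈ thetaDomain := hD
  have hx0 : x ≠ 0 := hx.ne'
  have hD0 : x - Real.sqrt 2 * y * Real.exp z ≠ 0 := hD.ne'
  have hs : Real.sqrt 2 ^ 2 = 2 := Real.sq_sqrt (by norm_num)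
  refine ⟨fun α β => ?_, fun α β => ?_⟩
  · rw [pd_congr_of_isOpen isOpen_thetaDomain (fun _ _ _ => pd_θ00 β) α hT, pd_gradθ00 α β hT]
    simp only [cup, cF_eq _ _ _ hF, pd_θ0m1 _ hT]
    fin_cases α <;> fin_cases β <;>
      simp [Fin.sum_univ_three, eta, thirdFpot, hessθ00, gradθ0m1, exp_two_mul_eq_sq] <;>
      field_simp <;> grind
  · rw [pd_θ01, pd_gradθ01]
    simp only [cup, cF_eq _ _ _ hF, pd_θ00 _ hT]
    fin_cases α <;> fin_cases β <;>
      simp [Fin.sum_univ_three, eta, thirdFpot, gradθ00, exp_two_mul_eq_sq] <;>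
      field_simp <;> grind
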